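/- For every positive integer n and every prime p: p divides v_{np} if and only if p divides v_n. Moreover, if p is an odd prime, then v_n divides v_{np} and v_{np}/v_n ≡ v_n^{p−1} (mod p). -/

import Mathlib

/-- Lucas sequence of the second kind: `v 0 = 2`, `v 1 = P`,
`v (n+2) = P * v (n+1) - Q * v n`. -/
def lucasV (P Q : ℤ) : ℕ → ℤ
  | 0 => 2
  | 1 => P
  | n + 2 => P * lucasV P Q (n + 1) - Q * lucasV P Q n

open Polynomial in
theorem eval_add_dickson_one_mul {R : Type*} [CommRing R] (x y : R) :
    ∀ n, (dickson 1 (x * y) n).eval (x + y) = x ^ n + y ^ n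
  | 0 => by simp [dickson_zero]; norm_num
  | 1 => by simp
  | n + 2 => by
    simp only [dickson_add_two, eval_sub, eval_mul, eval_X, eval_C,
      eval_add_dickson_one_mul x y n, eval_add_dickson_one_mul x y (n + 1)]
    ring

/-- Every pair `t, b` is the sum and the product of two elements of a ring extension. -/
theorem exists_add_eq_and_mul_eq {R : Type*} [CommRing R] (t b : R) :
    ∃ x y : QuadraticAlgebra R (-b) t,
      x + y = algebraMap R (QuadraticAlgebra R (-b) t) t ∧
      x * y = algebraMap R (QuadraticAlgebra R (-b) t) b := by
  refine ⟨⟨0, 1⟩, ⟨t, -1⟩, ?_, ?_⟩ <;>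
    ext <;> simp [QuadraticAlgebra.algebraMap_eq]

open Polynomial in
theorem algebraMap_eval_dickson {R S : Type*} [CommRing R] [CommRing S] [Algebra R S]
    (t b : R) (n : ℕ) {x y : S} (hadd : x + y = algebraMap R S t)
    (hmul : x * y = algebraMap R S b) :
    algebraMap R S ((dickson 1 b n).eval t) = x ^ n + y ^ n := by
  rw [← eval_add_dickson_one_mul, hadd, hmul, ← map_dickson, eval_map, eval₂_at_apply]

open Polynomial in
theorem eval_dickson_one_mul {R : Type*} [CommRing R] (t b : R) (m n : ℕ) :
    (dickson 1 b (m * n)).eval t = (dickson 1 (b ^ m) n).eval ((dickson 1 b m).eval t) := by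
  obtain ⟨x, y, hadd, hmul⟩ := exists_add_eq_and_mul_eq t b
  apply QuadraticAlgebra.algebraMap_injective (R := R) (a := -b) (b := t)
  rw [algebraMap_eval_dickson t b _ hadd hmul,
    algebraMap_eval_dickson (x := x ^ m) (y := y ^ m) _ _ _
      (algebraMap_eval_dickson t b m hadd hmul).symm (by rw [← mul_pow, hmul, map_pow]),
    pow_mul, pow_mul]

open Polynomial in
theorem eval_dickson_one_char {R : Type*} [CommRing R] (p : ℕ) [Fact p.Prime] [CharP R p]
    (t b : R) : (dickson 1 b p).eval t = t ^ p := by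
  obtain ⟨x, y, hadd, hmul⟩ := exists_add_eq_and_mul_eq t b
  have hinj := QuadraticAlgebra.algebraMap_injective (R := R) (a := -b) (b := t)
  have := charP_of_injective_algebraMap hinj p
  apply hinj
  rw [algebraMap_eval_dickson t b _ hadd hmul, ← add_pow_char, hadd, map_pow]

open Polynomial in
theorem dickson_one_char {R : Type*} [CommRing R] (p : ℕ) [Fact p.Prime] [CharP R p]
    (b : R) : dickson 1 b p = X ^ p := by
  have h := eval_dickson_one_char p (X : R[X]) (C b)
  rwa [← map_dickson, eval_map, eval₂_C_X] at h

open Polynomial in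
theorem X_dvd_dickson_one_of_odd {R : Type*} [CommRing R] (b : R) {n : ℕ} (hn : Odd n) :
    X ∣ dickson 1 b n := by
  obtain ⟨k, rfl⟩ := hn
  induction k with
  | zero => simp
  | succ k ih =>
    rw [show 2 * (k + 1) + 1 = (2 * k + 1) + 2 by ring, dickson_add_two]
    exact dvd_sub (dvd_mul_right _ _) (ih.mul_left _)

open Polynomial in
theorem lucasV_eq_eval_dickson (P Q : ℤ) : ∀ n, lucasV P Q n = (dickson 1 Q n).eval P
  | 0 => by simp [lucasV, dickson_zero]
  | 1 => by simp [lucasV]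
  | n + 2 => by
    simp [lucasV, dickson_add_two, lucasV_eq_eval_dickson P Q n,
      lucasV_eq_eval_dickson P Q (n + 1)]

/-- For `n ≥ 1` and `p` prime, `p ∣ v_{np}` iff `p ∣ v_n`; moreover,
for `p` odd, `v_n ∣ v_{np}` and `v_{np}/v_n ≡ v_n^(p-1) (mod p)`. -/
theorem lucasV_dvd_mul_prime (P Q : ℤ) (n : ℕ) (hn : 0 < n) (p : ℕ) (hp : p.Prime) :
    ((p : ℤ) ∣ lucasV P Q (n * p) ↔ (p : ℤ) ∣ lucasV P Q n) ∧
      (p ≠ 2 → ∃ c : ℤ, lucasV P Q (n * p) = lucasV P Q n * c ∧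
        (p : ℤ) ∣ c - lucasV P Q n ^ (p - 1)) := by
  have : Fact p.Prime := ⟨hp⟩
  have hcomp : lucasV P Q (n * p) =
      (Polynomial.dickson 1 (Q ^ n) p).eval (lucasV P Q n) := by
    simp only [lucasV_eq_eval_dickson, eval_dickson_one_mul]
  have hmap : (Polynomial.dickson 1 (Q ^ n) p).map (Int.castRingHom (ZMod p)) =
      Polynomial.X ^ p := by
    rw [Polynomial.map_dickson, dickson_one_char]
  have hcast (f : Polynomial ℤ) (t : ℤ) : ((f.eval t : ℤ) : ZMod p) =
      (f.map (Int.castRingHom (ZMod p))).eval (t : ZMod p) := by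
    simp
  rw [hcomp]
  refine ⟨?_, fun hp2 => ?_⟩
  · rw [← ZMod.intCast_zmod_eq_zero_iff_dvd, ← ZMod.intCast_zmod_eq_zero_iff_dvd, hcast, hmap]
    simp
  · obtain ⟨f, hf⟩ := X_dvd_dickson_one_of_odd (Q ^ n) (hp.odd_of_ne_two hp2)
    refine ⟨f.eval (lucasV P Q n), by simp [hf], ?_⟩
    have hfmap : f.map (Int.castRingHom (ZMod p)) = Polynomial.X ^ (p - 1) := by
      apply mul_left_cancel₀ (Polynomial.X_ne_zero (R := ZMod p))
      rw [mul_pow_sub_one hp.ne_zero, ← hmap, hf, Polynomial.map_mul, Polynomial.map_X]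
    rw [← ZMod.intCast_zmod_eq_zero_iff_dvd, Int.cast_sub, hcast, hfmap]
    simp
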